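/- Let X̄ ∈ Sⁿ with distinct eigenvalues v̄1 > … > v̄r and index sets α^l, let θ1 = φ1∘λ with φ1 symmetric convex piecewise affine, and let Ȳ ∈ ∂θ1(X̄) with Ū ∈ 𝕆ⁿ(X̄) ∩ 𝕆ⁿ(Ȳ). Define Υ¹_{X̄}(Ȳ,H) := 2 ∑_{l=1}^{r} ⟨ Λ(Ȳ)_{α^l α^l}, Ūᵀ_{α^l} H (X̄ − v̄_l I)† H Ū_{α^l} ⟩. Then for every H ∈ Sⁿ, Υ¹_{X̄}(Ȳ,H) = −2 ∑_{1≤l<l'≤r} ∑_{i∈α^l} ∑_{j∈α^{l'}} [(λ_i(Ȳ) − λ_j(Ȳ)) / (λ_i(X̄) − λ_j(X̄))] · ((Ūᵀ_{α^l} H Ū_{α^{l'}})_{ij})², and consequently Υ¹_{X̄}(Ȳ,H) ≤ 0 for all H ∈ Sⁿ. -/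

import Mathlib

open Matrix Filter Topology Set
open scoped Classical

noncomputable section

/-- The vector of eigenvalues of a symmetric matrix, in non-increasing order. -/
noncomputable def lamVec {n : ℕ} (X : Matrix (Fin n) (Fin n) ℝ) : Fin n → ℝ :=
  if h : X.IsHermitian then fun i => (h.eigenvalues ∘ Tuple.sort h.eigenvalues) i.rev else 0

/-- The set `𝕆ⁿ(X)` of orthogonal matrices giving an ordered eigenvalue decomposition of `X`. -/
def OSet {n : ℕ} (X : Matrix (Fin n) (Fin n) ℝ) : Set (Matrix (Fin n) (Fin n) ℝ) :=
  {U | Uᵀ * U = 1 ∧ X = U * Matrix.diagonal (lamVec X) * Uᵀ}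

/-- One-sided directional derivative of a scalar function. -/
noncomputable def dirDeriv {E : Type*} [AddCommMonoid E] [Module ℝ E] (f : E → ℝ) (x h : E) : ℝ :=
  limUnder (𝓝[>] (0:ℝ)) fun t => (f (x + t • h) - f x) / t

/-- Vector of one-sided directional derivatives of the ordered eigenvalues: `λ'(X;H)`. -/
noncomputable def lamDD {n : ℕ} (X H : Matrix (Fin n) (Fin n) ℝ) : Fin n → ℝ :=
  fun i => dirDeriv (fun Y => lamVec Y i) X H

/-- The max-of-affine convex piecewise affine function `φ(x) = max_i (⟨aⁱ,x⟩ - cᵢ)`. -/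
noncomputable def pwa {n p : ℕ} [NeZero p] (a : Fin p → Fin n → ℝ) (c : Fin p → ℝ)
    (x : Fin n → ℝ) : ℝ :=
  ⨆ i, (a i ⬝ᵥ x - c i)

/-- The active index set `ι(x̄)` of a max-of-affine function at `x̄`. -/
def iotaA {n p : ℕ} [NeZero p] (a : Fin p → Fin n → ℝ) (c : Fin p → ℝ)
    (x : Fin n → ℝ) : Set (Fin p) :=
  {i | a i ⬝ᵥ x - c i = pwa a c x}

/-- Frobenius inner product of two matrices. -/
def mip {n : ℕ} (A B : Matrix (Fin n) (Fin n) ℝ) : ℝ := (Aᵀ * B).trace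

/-- Convex subdifferential (over the space of symmetric matrices) of a real function. -/
def msubdiff {n : ℕ} (f : Matrix (Fin n) (Fin n) ℝ → ℝ) (X : Matrix (Fin n) (Fin n) ℝ) :
    Set (Matrix (Fin n) (Fin n) ℝ) :=
  {G | G.IsSymm ∧ ∀ Y : Matrix (Fin n) (Fin n) ℝ, Y.IsSymm → f X + mip G (Y - X) ≤ f Y}

/-- Moore–Penrose pseudo-inverse, via the four Penrose conditions. -/
noncomputable def mpInv {n : ℕ} (A : Matrix (Fin n) (Fin n) ℝ) : Matrix (Fin n) (Fin n) ℝ :=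
  Classical.epsilon fun B => A * B * A = A ∧ B * A * B = B ∧ (A * B)ᵀ = A * B ∧ (B * A)ᵀ = B * A

/-- The sigma-term function
`Υ_X(Y,H) = 2 ∑_l ⟨Λ(Y)_{αˡαˡ}, Uᵀ_{αˡ} H (X - v̄ₗ I)† H U_{αˡ}⟩` (written as a single sum
over eigenvalue indices). -/
noncomputable def Upsilon {n : ℕ} (X Y U H : Matrix (Fin n) (Fin n) ℝ) : ℝ :=
  2 * ∑ i, lamVec Y i *
    ((Uᵀ * H * mpInv (X - lamVec X i • (1 : Matrix (Fin n) (Fin n) ℝ)) * H * U) i i)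

theorem lamVec_antitone {n : ℕ} (X : Matrix (Fin n) (Fin n) ℝ) : Antitone (lamVec X) := by
  intro i j hij
  unfold lamVec
  split_ifs with h
  · exact Tuple.monotone_sort h.eigenvalues (Fin.rev_le_rev.mpr hij)
  · exact le_rfl

theorem penrose_unique {n : ℕ} (A B C : Matrix (Fin n) (Fin n) ℝ)
    (hB : A * B * A = A ∧ B * A * B = B ∧ (A * B)ᵀ = A * B ∧ (B * A)ᵀ = B * A)
    (hC : A * C * A = A ∧ C * A * C = C ∧ (A * C)ᵀ = A * C ∧ (C * A)ᵀ = C * A) : B = C := by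
  obtain ⟨b1, b2, b3, b4⟩ := hB
  obtain ⟨c1, c2, c3, c4⟩ := hC
  have e1 : A * B = A * C := by
    calc A * B = (A * C * A) * B := by rw [c1]
      _ = (A * C)ᵀ * (A * B)ᵀ := by rw [c3, b3]; simp only [Matrix.mul_assoc]
      _ = ((A * B * A) * C)ᵀ := by rw [← Matrix.transpose_mul]; simp only [Matrix.mul_assoc]
      _ = A * C := by rw [b1, c3]
  have e2 : B * A = C * A := by
    calc B * A = B * (A * C * A) := by rw [c1]
      _ = (B * A)ᵀ * (C * A)ᵀ := by rw [c4, b4]; simp only [Matrix.mul_assoc]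
      _ = (C * (A * B * A))ᵀ := by rw [← Matrix.transpose_mul]; simp only [Matrix.mul_assoc]
      _ = C * A := by rw [b1, c4]
  calc B = B * A * B := b2.symm
    _ = C * (A * B) := by rw [e2, Matrix.mul_assoc]
    _ = C * A * C := by rw [e1, Matrix.mul_assoc]
    _ = C := c2

theorem orth_conj_mul {n : ℕ} (U : Matrix (Fin n) (Fin n) ℝ) (hU : Uᵀ * U = 1) (d e : Fin n → ℝ) :
    (U * diagonal d * Uᵀ) * (U * diagonal e * Uᵀ) = U * diagonal (fun i => d i * e i) * Uᵀ := by
  calc (U * diagonal d * Uᵀ) * (U * diagonal e * Uᵀ)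
      = U * diagonal d * (Uᵀ * U) * diagonal e * Uᵀ := by simp only [Matrix.mul_assoc]
    _ = _ := by rw [hU, Matrix.mul_one, Matrix.mul_assoc U, Matrix.diagonal_mul_diagonal]

theorem mpInv_conj {n : ℕ} (U : Matrix (Fin n) (Fin n) ℝ) (hU : Uᵀ * U = 1) (d : Fin n → ℝ) :
    mpInv (U * diagonal d * Uᵀ) = U * diagonal (fun i => (d i)⁻¹) * Uᵀ := by
  have key : (fun B => (U * diagonal d * Uᵀ) * B * (U * diagonal d * Uᵀ) = (U * diagonal d * Uᵀ) ∧
      B * (U * diagonal d * Uᵀ) * B = B ∧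
      ((U * diagonal d * Uᵀ) * B)ᵀ = (U * diagonal d * Uᵀ) * B ∧
      (B * (U * diagonal d * Uᵀ))ᵀ = B * (U * diagonal d * Uᵀ))
      (U * diagonal (fun i => (d i)⁻¹) * Uᵀ) := by
    simp only [orth_conj_mul U hU]
    refine ⟨?_, ?_, ?_, ?_⟩
    · congr 3; ext i; exact mul_inv_mul_cancel _
    · congr 3; ext i; by_cases h : d i = 0 <;> simp [h]
    · simp [Matrix.transpose_mul, Matrix.mul_assoc]
    · simp [Matrix.transpose_mul, Matrix.mul_assoc]
  exact penrose_unique _ _ _ (Classical.epsilon_spec (p := fun B => (U * diagonal d * Uᵀ) * B * (U * diagonal d * Uᵀ) = (U * diagonal d * Uᵀ) ∧ B * (U * diagonal d * Uᵀ) * B = B ∧ ((U * diagonal d * Uᵀ) * B)ᵀ = (U * diagonal d * Uᵀ) * B ∧ (B * (U * diagonal d * Uᵀ))ᵀ = B * (U * diagonal d * Uᵀ)) ⟨_, key⟩) key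

theorem upsilon_entry {n : ℕ} (X U H : Matrix (Fin n) (Fin n) ℝ) (hU : U ∈ OSet X)
    (hH : H.IsSymm) (i : Fin n) :
    (Uᵀ * H * mpInv (X - lamVec X i • (1 : Matrix (Fin n) (Fin n) ℝ)) * H * U) i i =
      ∑ j, (lamVec X j - lamVec X i)⁻¹ * ((Uᵀ * H * U) i j)^2 := by
  obtain ⟨h1, h2⟩ := hU
  have h1' : U * Uᵀ = 1 := mul_eq_one_comm.mp h1
  have e : X - lamVec X i • (1 : Matrix (Fin n) (Fin n) ℝ) =
      U * diagonal (fun j => lamVec X j - lamVec X i) * Uᵀ := by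
    have : diagonal (fun j => lamVec X j - lamVec X i) =
        diagonal (lamVec X) - lamVec X i • (1 : Matrix (Fin n) (Fin n) ℝ) := by
      rw [Matrix.smul_one_eq_diagonal, Matrix.diagonal_sub]
    rw [this, Matrix.mul_sub, Matrix.sub_mul, ← h2]
    simp [h1']
  rw [e, mpInv_conj U h1]
  have hG : (Uᵀ * H * U)ᵀ = Uᵀ * H * U := by
    simp [Matrix.transpose_mul, Matrix.mul_assoc, hH.eq]
  have : Uᵀ * H * (U * diagonal (fun j => (lamVec X j - lamVec X i)⁻¹) * Uᵀ) * H * U =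
      (Uᵀ * H * U) * diagonal (fun j => (lamVec X j - lamVec X i)⁻¹) * (Uᵀ * H * U) := by
    simp only [Matrix.mul_assoc]
  rw [this, Matrix.mul_apply]
  refine Finset.sum_congr rfl fun j _ => ?_
  rw [Matrix.mul_diagonal]
  have : (Uᵀ * H * U) j i = (Uᵀ * H * U) i j := congrFun (congrFun hG i) j
  rw [this]; ring

/-- Remark 3.1.  For `Ȳ ∈ ∂θ₁(X̄)` and `Ū ∈ 𝕆ⁿ(X̄) ∩ 𝕆ⁿ(Ȳ)`, the
sigma-term function satisfies
`Υ¹_{X̄}(Ȳ,H) = -2 ∑_{λᵢ(X̄) > λⱼ(X̄)} [(λᵢ(Ȳ)-λⱼ(Ȳ))/(λᵢ(X̄)-λⱼ(X̄))] ((ŪᵀHŪ)_{ij})²`,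
and hence `Υ¹_{X̄}(Ȳ,H) ≤ 0`, for every symmetric `H`. -/
theorem stmt8 {n p : ℕ} [NeZero p]
    (a : Fin p → Fin n → ℝ) (c : Fin p → ℝ)
    (hsym : ∀ (σ : Equiv.Perm (Fin n)) (x : Fin n → ℝ), pwa a c (x ∘ σ) = pwa a c x)
    (theta1 : Matrix (Fin n) (Fin n) ℝ → ℝ)
    (htheta1 : theta1 = fun X => pwa a c (lamVec X))
    (Xb : Matrix (Fin n) (Fin n) ℝ) (hXb : Xb.IsSymm)
    (Yb : Matrix (Fin n) (Fin n) ℝ) (hYb : Yb ∈ msubdiff theta1 Xb)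
    (Ub : Matrix (Fin n) (Fin n) ℝ) (hUb : Ub ∈ OSet Xb ∩ OSet Yb)
    (H : Matrix (Fin n) (Fin n) ℝ) (hH : H.IsSymm) :
    Upsilon Xb Yb Ub H =
      -2 * ∑ i : Fin n, ∑ j : Fin n,
        (if lamVec Xb j < lamVec Xb i then
          (lamVec Yb i - lamVec Yb j) / (lamVec Xb i - lamVec Xb j) * ((Ubᵀ * H * Ub) i j)^2
        else 0) ∧
    Upsilon Xb Yb Ub H ≤ 0 := by
  have hG : (Ubᵀ * H * Ub)ᵀ = Ubᵀ * H * Ub := by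
    simp [Matrix.transpose_mul, Matrix.mul_assoc, hH.eq]
  have hG' : ∀ i j, (Ubᵀ * H * Ub) j i = (Ubᵀ * H * Ub) i j :=
    fun i j => congrFun (congrFun hG i) j
  have main : Upsilon Xb Yb Ub H =
      -2 * ∑ i : Fin n, ∑ j : Fin n,
        (if lamVec Xb j < lamVec Xb i then
          (lamVec Yb i - lamVec Yb j) / (lamVec Xb i - lamVec Xb j) * ((Ubᵀ * H * Ub) i j)^2
        else 0) := by
    unfold Upsilon
    simp only [upsilon_entry Xb Ub H hUb.1 hH]
    generalize Ubᵀ * H * Ub = G at hG'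
    generalize lamVec Xb = x
    generalize lamVec Yb = y
    have s1 : ∑ i : Fin n, ∑ j : Fin n,
        (if x j < x i then (y i - y j) / (x i - x j) * (G i j)^2 else 0) =
        ∑ i : Fin n, ∑ j : Fin n, (if x j < x i then y i / (x i - x j) * (G i j)^2 else 0) -
        ∑ i : Fin n, ∑ j : Fin n, (if x j < x i then y j / (x i - x j) * (G i j)^2 else 0) := by
      simp only [← Finset.sum_sub_distrib]
      refine Finset.sum_congr rfl fun i _ => Finset.sum_congr rfl fun j _ => ?_
      split_ifs <;> ring
    rw [s1, Finset.sum_comm (f := fun i j => if x j < x i then y j / (x i - x j) * (G i j)^2 else 0)]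
    simp only [← Finset.sum_sub_distrib]
    rw [neg_mul, ← mul_neg, ← Finset.sum_neg_distrib]
    congr 1
    refine Finset.sum_congr rfl fun i _ => ?_
    rw [← Finset.sum_neg_distrib, Finset.mul_sum]
    refine Finset.sum_congr rfl fun j _ => ?_
    rw [hG' i j]
    rcases lt_trichotomy (x j) (x i) with h | h | h
    · rw [if_pos h, if_neg h.not_gt, ← neg_sub (x i) (x j), inv_neg]; ring
    · simp [h]
    · rw [if_neg h.not_gt, if_pos h]; ring
  refine ⟨main, ?_⟩
  rw [main]
  have : 0 ≤ ∑ i : Fin n, ∑ j : Fin n,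
        (if lamVec Xb j < lamVec Xb i then
          (lamVec Yb i - lamVec Yb j) / (lamVec Xb i - lamVec Xb j) * ((Ubᵀ * H * Ub) i j)^2
        else 0) := by
    refine Finset.sum_nonneg fun i _ => Finset.sum_nonneg fun j _ => ?_
    split_ifs with h
    · have hij : i ≤ j := ((lamVec_antitone Xb).reflect_lt h).le
      have hy := lamVec_antitone Yb hij
      exact mul_nonneg (div_nonneg (sub_nonneg.mpr hy) (sub_nonneg.mpr h.le)) (sq_nonneg _)
    · exact le_rfl
  linarith

end
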